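/- Let G be a graph, r a positive integer, and suppose that for every S ⊆ V(G) we have iso(G−S) ≤ |S|/r and (r−1)·w_*(G−S) + ω(G−S) ≤ |S| + 1, where w_*(G−S) is the number of star components of G−S. Then G admits a near r-factor (a spanning subgraph with all degrees r except at most one vertex of degree r+1). -/

import Mathlib

open Classical Finset

/-- The set of isolated vertices of `G − S`: vertices outside `S` all of whose
neighbors lie in `S`. -/
def SimpleGraph.isoVerts {V : Type*} (G : SimpleGraph V) (S : Finset V) : Set V :=
  {v | v ∉ S ∧ ∀ w, G.Adj v w → w ∈ S}

/-- `iso(G − S)`, the number of isolated vertices of `G − S`. -/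
noncomputable def SimpleGraph.isoCount {V : Type*} (G : SimpleGraph V) (S : Finset V) : ℕ :=
  (G.isoVerts S).ncard

/-- `ω(G − S)`, the number of connected components of `G − S`. -/
noncomputable def SimpleGraph.compCount {V : Type*} (G : SimpleGraph V) (S : Finset V) : ℕ :=
  Nat.card (G.induce ((↑S : Set V)ᶜ)).ConnectedComponent

/-- `G` is `t`-tough: `ω(G−S) ≤ max {1, |S|/t}` for all `S ⊆ V(G)`. -/
def SimpleGraph.IsTough {V : Type*} [Fintype V] (t : ℝ) (G : SimpleGraph V) : Prop :=
  ∀ S : Finset V, (G.compCount S : ℝ) ≤ max 1 ((S.card : ℝ) / t)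

/-- A connected component is a star if it has a center adjacent to every other vertex
of the component, and every other vertex has the center as its only neighbor
(singleton components count as stars). -/
def IsStarComponent {α : Type*} (G' : SimpleGraph α) (c : G'.ConnectedComponent) : Prop :=
  ∃ u ∈ c.supp, ∀ v ∈ c.supp, v ≠ u → G'.Adj u v ∧ ∀ w, G'.Adj v w → w = u

/-- `w_*(G − S)`: the number of star components of `G − S`. -/
noncomputable def SimpleGraph.starCompCount {V : Type*} (G : SimpleGraph V)
    (S : Finset V) : ℕ :=
  {c : (G.induce ((↑S : Set V)ᶜ)).ConnectedComponent |
    IsStarComponent _ c}.ncard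

/-- A near `r`-factor of `G`: a spanning subgraph in which every vertex has degree `r`,
except for at most one vertex, which has degree `r + 1`. -/
noncomputable def SimpleGraph.HasNearRegularFactor {V : Type*} [Fintype V]
    (G : SimpleGraph V) (r : ℕ) : Prop :=
  ∃ F : SimpleGraph V, F ≤ G ∧ (∀ v, F.degree v = r ∨ F.degree v = r + 1) ∧
    ∀ u v, F.degree u = r + 1 → F.degree v = r + 1 → u = v

namespace SimpleGraph

/-- Greedy choice, by decreasing weight, of a maximal independent subset of `T`. -/
theorem exists_dominating_independent_weight_le {V : Type*} (G : SimpleGraph V) (w : V → ℕ)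
    (T : Finset V) :
    ∃ I ⊆ T, (∀ u ∈ I, ∀ v ∈ I, ¬ G.Adj u v) ∧ (∀ v ∈ T, v ∉ I → ∃ u ∈ I, G.Adj u v) ∧
      ∑ v ∈ T, w v ≤ ∑ v ∈ I, (1 + #{u ∈ T | G.Adj v u}) * w v := by
  induction T using Finset.strongInduction with
  | H T ih =>
  rcases T.eq_empty_or_nonempty with rfl | hne
  · exact ⟨∅, by simp⟩
  obtain ⟨x, hx, hmax⟩ := T.exists_max_image w hne
  set N : Finset V := insert x {u ∈ T | G.Adj x u} with hN
  have hNT : N ⊆ T := by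
    intro y hy
    simp only [hN, mem_insert, mem_filter] at hy
    rcases hy with rfl | hy
    exacts [hx, hy.1]
  have hxN : x ∈ N := mem_insert_self _ _
  obtain ⟨I, hIT, hind, hdom, hsum⟩ := ih (T \ N) (sdiff_ssubset hNT ⟨x, hxN⟩)
  have hadj : ∀ v ∈ I, ¬ G.Adj x v := fun v hv h => by
    have := mem_sdiff.1 (hIT hv)
    exact this.2 (by simp [hN, this.1, h])
  have hxI : x ∉ I := fun h => (mem_sdiff.1 (hIT h)).2 hxN
  refine ⟨insert x I, ?_, ?_, ?_, ?_⟩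
  · exact insert_subset hx (hIT.trans sdiff_subset)
  · intro u hu v hv h
    rw [mem_insert] at hu hv
    rcases hu with rfl | hu <;> rcases hv with rfl | hv
    · exact G.irrefl h
    · exact hadj v hv h
    · exact hadj u hu h.symm
    · exact hind u hu v hv h
  · intro v hv hvI
    rw [mem_insert, not_or] at hvI
    by_cases hvN : v ∈ N
    · simp only [hN, mem_insert, mem_filter] at hvN
      exact ⟨x, mem_insert_self _ _, (hvN.resolve_left hvI.1).2⟩
    · obtain ⟨u, hu, h⟩ := hdom v (mem_sdiff.2 ⟨hv, hvN⟩) hvI.2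
      exact ⟨u, mem_insert_of_mem hu, h⟩
  · rw [sum_insert hxI, ← sum_sdiff hNT, add_comm]
    refine add_le_add ?_ (hsum.trans (sum_le_sum fun v _ => ?_))
    · refine (sum_le_card_nsmul N w (w x) fun v hv => hmax v (hNT hv)).trans ?_
      rw [smul_eq_mul]
      refine Nat.mul_le_mul_right _ ?_
      rw [add_comm]
      exact card_insert_le _ _
    · gcongr
      exact sdiff_subset

theorem eq_of_connectedComponentMk_eq {V α : Type*} {G : SimpleGraph V} {φ : V → α}
    (hφ : ∀ u v, G.Adj u v → φ u = φ v) {x y : V}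
    (h : G.connectedComponentMk x = G.connectedComponentMk y) : φ x = φ y := by
  obtain ⟨p⟩ := ConnectedComponent.exact h
  induction p with
  | nil => rfl
  | cons hadj p ih => exact (hφ _ _ hadj).trans (ih (ConnectedComponent.sound ⟨p⟩))

theorem eq_of_induce_connectedComponentMk_eq {V α : Type*} {G : SimpleGraph V} {s : Set V}
    {φ : V → α} (hφ : ∀ u ∈ s, ∀ v ∈ s, G.Adj u v → φ u = φ v) {x y : s}
    (h : (G.induce s).connectedComponentMk x = (G.induce s).connectedComponentMk y) :
    φ x = φ y :=
  eq_of_connectedComponentMk_eq (φ := fun z : s => φ z)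
    (fun u v huv => hφ u u.2 v v.2 huv) h

/-- A function invariant under adjacency within `s` and injective on `Q` separates the
components of `G[s]` that meet `Q`. -/
theorem card_le_ncard_components {V α : Type*} [Finite V] {G : SimpleGraph V} {s : Set V}
    {φ : V → α} (hφ : ∀ u ∈ s, ∀ v ∈ s, G.Adj u v → φ u = φ v) {Q : Finset V}
    (hinj : Set.InjOn φ Q) {C : Set (G.induce s).ConnectedComponent}
    (hQ : ∀ x ∈ Q, ∃ h : x ∈ s, (G.induce s).connectedComponentMk ⟨x, h⟩ ∈ C) :
    #Q ≤ C.ncard := by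
  choose h₁ h₂ using hQ
  rw [← Nat.card_coe_set_eq, ← Nat.card_eq_finsetCard]
  refine (Nat.card_le_card_of_injective (α := Q) (β := C) (fun x => ⟨_, h₂ x x.2⟩) ?_)
  intro x y hxy
  exact Subtype.ext (hinj x.2 y.2 (eq_of_induce_connectedComponentMk_eq hφ (Subtype.ext_iff.1 hxy)))


/-- Representatives of the components of `G[s]` minimizing a given weight `a`. -/
theorem exists_component_representatives {V : Type*} [Fintype V] (G : SimpleGraph V)
    (s : Set V) (a : V → ℕ) :
    ∃ ρ : V → V, (∀ u ∈ s, ρ u ∈ s ∧ ρ (ρ u) = ρ u ∧ a (ρ u) ≤ a u) ∧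
      (∀ u ∈ s, ∀ v ∈ s, G.Adj u v → ρ u = ρ v) ∧
      Nat.card (G.induce s).ConnectedComponent = #{u | u ∈ s ∧ ρ u = u} := by
  have hex : ∀ c : (G.induce s).ConnectedComponent, ∃ x : s,
      (G.induce s).connectedComponentMk x = c ∧
      ∀ y : s, (G.induce s).connectedComponentMk y = c → a x ≤ a y := by
    intro c
    obtain ⟨x, hx, hmin⟩ := Finset.exists_min_image
      ({x | (G.induce s).connectedComponentMk x = c} : Finset s) (fun x => a x)
      (by obtain ⟨x, hx⟩ := c.exists_rep; exact ⟨x, mem_filter.2 ⟨mem_univ _, hx⟩⟩)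
    exact ⟨x, by simpa using hx, fun y hy => hmin y (by simpa using hy)⟩
  choose r hr hmin using hex
  let ρ : V → V := fun u =>
    if h : u ∈ s then (r ((G.induce s).connectedComponentMk ⟨u, h⟩) : V) else u
  have hρ : ∀ u (h : u ∈ s), ρ u = r ((G.induce s).connectedComponentMk ⟨u, h⟩) :=
    fun u h => dif_pos h
  refine ⟨ρ, fun u hu => ⟨?_, ?_, ?_⟩, fun u hu v hv h => ?_, ?_⟩
  · rw [hρ u hu]; exact Subtype.coe_prop _
  · rw [hρ u hu, hρ _ (Subtype.coe_prop _), hr]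
  · rw [hρ u hu]; exact hmin _ ⟨u, hu⟩ rfl
  · rw [hρ u hu, hρ v hv]
    have : (G.induce s).Adj ⟨u, hu⟩ ⟨v, hv⟩ := h
    rw [ConnectedComponent.sound this.reachable]
  · rw [← Nat.card_eq_finsetCard]
    refine Nat.card_congr (Equiv.ofBijective (fun c => ⟨r c, ?_⟩) ⟨?_, ?_⟩)
    · simp only [mem_filter, mem_univ, true_and]
      exact ⟨Subtype.coe_prop _, by rw [hρ _ (Subtype.coe_prop _), hr]⟩
    · intro c d h
      rw [← hr c, ← hr d]
      exact congrArg _ (Subtype.ext (congrArg Subtype.val h :))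
    · rintro ⟨u, hu⟩
      simp only [mem_filter, mem_univ, true_and] at hu
      exact ⟨_, Subtype.ext ((hρ u hu.1).symm.trans hu.2)⟩

theorem sum_card_adj_comm {V : Type*} (G : SimpleGraph V) (A B : Finset V) :
    ∑ u ∈ A, #{v ∈ B | G.Adj u v} = ∑ v ∈ B, #{u ∈ A | G.Adj v u} := by
  refine (sum_card_bipartiteAbove_eq_sum_card_bipartiteBelow G.Adj).trans
    (sum_congr rfl fun v _ => ?_)
  simp only [bipartiteBelow, G.adj_comm v]

/-- The isolated-vertex bound, applied to the neighbourhood of an independent set. -/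
theorem mul_card_le_of_isoCount_le {V : Type*} [Fintype V] {G : SimpleGraph V} {r : ℕ}
    (hiso : ∀ S : Finset V, r * G.isoCount S ≤ #S) {S I : Finset V} (hSI : Disjoint S I)
    (hI : ∀ u ∈ I, ∀ v ∈ I, ¬ G.Adj u v) :
    r * #I ≤ #S + ∑ v ∈ I, #{u ∈ Sᶜ | G.Adj v u} := by
  set W := S ∪ I.biUnion fun v => {u ∈ Sᶜ | G.Adj v u} with hW
  calc r * #I ≤ r * G.isoCount W := by
        gcongr
        rw [isoCount, ← Set.ncard_coe_finset]
        refine Set.ncard_le_ncard (fun v hv => ⟨?_, fun w hw => ?_⟩) (Set.toFinite _)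
        · simp only [hW, mem_union, mem_biUnion, mem_filter, not_or, not_exists, not_and]
          exact ⟨fun h => Finset.disjoint_left.1 hSI h hv, fun u hu _ => hI u hu v hv⟩
        · simp only [hW, mem_union, mem_biUnion, mem_filter, mem_compl]
          by_cases h : w ∈ S
          exacts [.inl h, .inr ⟨v, hv, h, hw⟩]
    _ ≤ #W := hiso W
    _ ≤ _ := (card_union_le _ _).trans (Nat.add_le_add_left card_biUnion_le _)

/-- The star-component bound, applied to an independent set `I ⊆ T` whose neighbours in
`V ∖ (S ∪ T)` are deleted except for at most one vertex in each component. -/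
theorem mul_card_add_compCount_le {V : Type*} [Fintype V] {G : SimpleGraph V} {r : ℕ}
    (hr : 0 < r)
    (hstar : ∀ S : Finset V, (r - 1) * G.starCompCount S + G.compCount S ≤ #S + 1)
    {S T I : Finset V} (hST : Disjoint S T) (hIT : I ⊆ T)
    (hI : ∀ u ∈ I, ∀ v ∈ I, ¬ G.Adj u v) :
    r * #I + G.compCount (S ∪ T) ≤
      #S + #(T \ I) + ∑ v ∈ I, #{u ∈ (S ∪ T)ᶜ | G.Adj v u} + 1 := by
  set U := (S ∪ T)ᶜ with hU
  set a : V → ℕ := fun u => #{v ∈ I | G.Adj u v} with ha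
  obtain ⟨ρ, hρ, hadj, hcard⟩ :=
    G.exists_component_representatives ((↑(S ∪ T) : Set V)ᶜ) a
  have hUmem : ∀ u, u ∈ ((↑(S ∪ T) : Set V)ᶜ) ↔ u ∈ U := by simp [hU]
  simp only [hUmem] at hρ hadj hcard
  have hpos : ∀ {u v}, v ∈ I → G.Adj u v → 0 < a u := fun hv h =>
    card_pos.2 ⟨_, mem_filter.2 ⟨hv, h⟩⟩
  have hUI : ∀ {u}, u ∈ U → u ∉ I := fun hu h => by
    rw [hU, mem_compl, mem_union] at hu
    exact hu (.inr (hIT h))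
  set Y : Finset V := {u ∈ U | 0 < a u ∧ ¬ (ρ u = u ∧ a u = 1)} with hY
  set W := S ∪ T \ I ∪ Y with hW
  set R : Finset V := {u ∈ U | ρ u = u ∧ a u = 0} with hR
  have hout : ∀ {x}, x ∉ W → x ∈ I ∨ x ∈ U ∧ (a x = 0 ∨ ρ x = x ∧ a x = 1) := by
    intro x hx
    simp only [hW, hY, hU, mem_union, mem_sdiff, mem_filter, mem_compl] at hx ⊢
    by_cases h : x ∈ I
    · exact .inl h
    · right; grind
  have hIW : ∀ {x}, x ∈ I → x ∉ W := by
    intro x hx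
    have h₁ := hIT hx
    have h₂ := Finset.disjoint_right.1 hST h₁
    simp only [hW, hY, hU, mem_union, mem_sdiff, mem_filter, mem_compl]
    grind
  have hRW : ∀ {x}, x ∈ R → x ∉ W := by
    intro x hx
    simp only [hR, hW, hY, hU, mem_union, mem_sdiff, mem_filter, mem_compl] at hx ⊢
    grind
  -- two retained vertices of `U` are adjacent only if neither has a neighbour in `I`
  have hUU : ∀ {x y}, x ∉ W → y ∉ W → x ∈ U → y ∈ U → G.Adj x y → a x = 0 := by
    intro x y hx hy hxU hyU h
    by_contra h0
    have hx' := (hout hx).resolve_left (hUI hxU)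
    have hy' := (hout hy).resolve_left (hUI hyU)
    have h1 := hadj x hxU y hyU h
    have h2 := (hρ y hyU).2.2
    have hρx := (hx'.2.resolve_left h0).1
    rw [← h1, hρx] at h2
    have hρy := (hy'.2.resolve_left (by omega)).1
    exact G.ne_of_adj h (by rw [← hρx, h1, hρy])
  let φ : V → V := fun x =>
    if x ∈ I then x else if h : ∃ v ∈ I, G.Adj x v then h.choose else ρ x
  have hφI : ∀ {x}, x ∈ I → φ x = x := fun hx => if_pos hx
  have hφ0 : ∀ {x}, x ∈ U → a x = 0 → φ x = ρ x := by
    intro x hx h0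
    have : ¬ ∃ v ∈ I, G.Adj x v := fun ⟨v, hv, h⟩ => (hpos hv h).ne' h0
    simp only [φ, if_neg (hUI hx), dif_neg this]
  have hφ1 : ∀ {x v}, x ∉ W → x ∈ U → v ∈ I → G.Adj x v → φ x = v := by
    intro x v hx hxU hv h
    have hex : ∃ v ∈ I, G.Adj x v := ⟨v, hv, h⟩
    have h1 : a x = 1 := by
      have := hpos hv h
      have := (hout hx).resolve_left (hUI hxU)
      grind
    simp only [φ, if_neg (hUI hxU), dif_pos hex]
    exact card_le_one.1 h1.le _ (mem_filter.2 hex.choose_spec) _ (mem_filter.2 ⟨hv, h⟩)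
  have hφ : ∀ u ∈ ((↑W : Set V)ᶜ), ∀ v ∈ ((↑W : Set V)ᶜ), G.Adj u v → φ u = φ v := by
    intro u hu v hv h
    simp only [Set.mem_compl_iff, mem_coe] at hu hv
    rcases hout hu with huI | ⟨huU, -⟩ <;> rcases hout hv with hvI | ⟨hvU, -⟩
    · exact absurd h (hI u huI v hvI)
    · rw [hφI huI, hφ1 hv hvU huI h.symm]
    · rw [hφI hvI, hφ1 hu huU hvI h]
    · rw [hφ0 huU (hUU hu hv huU hvU h), hφ0 hvU (hUU hv hu hvU huU h.symm),
        hadj u huU v hvU h]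
  have hφR : ∀ {x}, x ∈ R → φ x = x := by
    intro x hx
    have hx := mem_filter.1 hx
    rw [hφ0 hx.1 hx.2.2, hx.2.1]
  have hIR : Disjoint I R := Finset.disjoint_left.2 fun x hx hxR => hUI (mem_filter.1 hxR).1 hx
  have hcomp : #I + #R ≤ G.compCount W := by
    rw [← card_union_of_disjoint hIR, compCount, ← Set.ncard_univ]
    refine card_le_ncard_components hφ ?_ fun x hx => ⟨?_, Set.mem_univ _⟩
    · have : ∀ x ∈ I ∪ R, φ x = x := fun x hx =>
        (mem_union.1 hx).elim (fun h => hφI h) (fun h => hφR h)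
      intro x hx y hy h
      rwa [this x hx, this y hy] at h
    · exact (mem_union.1 hx).elim (fun h => hIW h) (fun h => hRW h)
  have hstars : #I ≤ G.starCompCount W := by
    rw [starCompCount]
    refine card_le_ncard_components hφ (fun x hx y hy h => ?_) fun x hx => ⟨hIW hx, ?_⟩
    · rwa [hφI hx, hφI hy] at h
    · refine ⟨⟨x, hIW hx⟩, rfl, ?_⟩
      rintro ⟨v, hvW⟩ hv hne
      have hne : v ≠ x := fun h => hne (Subtype.ext h)
      have hvx : φ v = x := (eq_of_induce_connectedComponentMk_eq hφ hv).trans (hφI hx)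
      have hvW' : v ∉ W := hvW
      have hvI : v ∉ I := fun h => hne ((hφI h).symm.trans hvx)
      have hvU := ((hout hvW').resolve_left hvI).1
      have hav : a v ≠ 0 := by
        intro h0
        rw [hφ0 hvU h0] at hvx
        exact hUI (hvx ▸ (hρ v hvU).1) hx
      obtain ⟨y, hy⟩ := card_pos.1 (Nat.pos_of_ne_zero hav)
      rw [mem_filter] at hy
      have hyx : y = x := (hφ1 hvW' hvU hy.1 hy.2).symm.trans hvx
      refine ⟨(hyx ▸ hy.2).symm, ?_⟩
      rintro ⟨w, hwW⟩ hw
      have hw : G.Adj v w := hw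
      have hwW' : w ∉ W := hwW
      rcases hout hwW' with hwI | ⟨hwU, -⟩
      · exact Subtype.ext ((hφ1 hvW' hvU hwI hw).symm.trans hvx)
      · exact absurd (hUU hvW' hwW' hvU hwU hw) hav
  have hYcard : #Y + G.compCount (S ∪ T) ≤ ∑ v ∈ I, #{u ∈ U | G.Adj v u} + #R := by
    rw [compCount, hcard, ← sum_card_adj_comm]
    have h₁ : #Y = ∑ u ∈ U, if 0 < a u ∧ ¬ (ρ u = u ∧ a u = 1) then 1 else 0 :=
      card_filter _ _
    have h₂ : #R = ∑ u ∈ U, if ρ u = u ∧ a u = 0 then 1 else 0 := card_filter _ _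
    have h₃ : #{u | u ∈ U ∧ ρ u = u} = ∑ u ∈ U, if ρ u = u then 1 else 0 := by
      rw [← card_filter, ← filter_filter]; simp
    rw [h₁, h₂, h₃, ← sum_add_distrib, ← sum_add_distrib]
    refine sum_le_sum fun u _ => ?_
    change _ ≤ a u + _
    split_ifs <;> grind
  have hWcard : #W ≤ #S + #(T \ I) + #Y :=
    (card_union_le _ _).trans (Nat.add_le_add_right (card_union_le _ _) _)
  have hmain := hstar W
  have hmul : (r - 1) * #I ≤ (r - 1) * G.starCompCount W := Nat.mul_le_mul_left _ hstars
  have hsplit : r * #I = (r - 1) * #I + #I := by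
    obtain ⟨k, rfl⟩ := Nat.exists_eq_add_of_lt hr
    simp; ring
  omega


/-- The two hypotheses give both Tutte-type inequalities, for all components and not only for
the odd ones. -/
theorem factor_inequalities {V : Type*} [Fintype V] {G : SimpleGraph V} {r : ℕ}
    (hr : 0 < r) (hiso : ∀ S : Finset V, r * G.isoCount S ≤ #S)
    (hstar : ∀ S : Finset V, (r - 1) * G.starCompCount S + G.compCount S ≤ #S + 1)
    {S T : Finset V} (hST : Disjoint S T) :
    r * #T ≤ r * #S + ∑ v ∈ T, #{u ∈ Sᶜ | G.Adj v u} ∧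
    r * #T + G.compCount (S ∪ T) ≤ r * #S + ∑ v ∈ T, #{u ∈ Sᶜ | G.Adj v u} + 1 := by
  set j : V → ℕ := fun v => #{u ∈ Sᶜ | G.Adj v u} with hj
  set T₁ : Finset V := {v ∈ T | j v ≤ r} with hT₁
  set T₂ : Finset V := {v ∈ T | ¬ j v ≤ r} with hT₂
  have hT₁T : T₁ ⊆ T := filter_subset _ _
  obtain ⟨I, hIT₁, hI, hdom, hsum⟩ :=
    G.exists_dominating_independent_weight_le (fun v => r - j v) T₁
  have hIT := hIT₁.trans hT₁T
  have hTS : T ⊆ Sᶜ := fun x hx => mem_compl.2 (Finset.disjoint_right.1 hST hx)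
  have hA := mul_card_le_of_isoCount_le hiso (hST.mono_right hIT) hI
  have hB := mul_card_add_compCount_le hr hstar hST hIT hI
  have hdeg : ∀ v, #{u ∈ T₁ | G.Adj v u} + #{u ∈ (S ∪ T)ᶜ | G.Adj v u} ≤ j v := by
    intro v
    rw [← card_union_of_disjoint]
    · refine card_le_card (union_subset (filter_subset_filter _ (hT₁T.trans hTS))
        (filter_subset_filter _ (compl_subset_compl.2 subset_union_left)))
    · refine disjoint_filter_filter (Finset.disjoint_left.2 fun x hx hx' => ?_)
      exact mem_compl.1 hx' (mem_union_right _ (hT₁T hx))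
  have hTI : #(T \ I) ≤ ∑ v ∈ I, #{u ∈ T₁ | G.Adj v u} + #T₂ := by
    have : T \ I ⊆ (I.biUnion fun v => {u ∈ T₁ | G.Adj v u}) ∪ T₂ := by
      intro x hx
      rw [mem_sdiff] at hx
      by_cases h : j x ≤ r
      · have hx₁ : x ∈ T₁ := mem_filter.2 ⟨hx.1, h⟩
        obtain ⟨u, hu, hux⟩ := hdom x hx₁ hx.2
        exact mem_union_left _ (mem_biUnion.2 ⟨u, hu, mem_filter.2 ⟨hx₁, hux⟩⟩)
      · exact mem_union_right _ (mem_filter.2 ⟨hx.1, h⟩)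
    exact (card_le_card this).trans ((card_union_le _ _).trans
      (Nat.add_le_add_right card_biUnion_le _))
  have hsumI : ∑ v ∈ I, #{u ∈ T₁ | G.Adj v u} + ∑ v ∈ I, #{u ∈ (S ∪ T)ᶜ | G.Adj v u} ≤
      ∑ v ∈ I, j v := by
    rw [← sum_add_distrib]; exact sum_le_sum fun v _ => hdeg v
  have hweight : ∑ v ∈ T₁, (r - j v) + r * ∑ v ∈ I, j v ≤ r * (r * #I) := by
    have : ∑ v ∈ I, (1 + #{u ∈ T₁ | G.Adj v u}) * (r - j v) + r * ∑ v ∈ I, j v ≤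
        ∑ v ∈ I, r * r := by
      rw [mul_sum, ← sum_add_distrib]
      refine sum_le_sum fun v hv => ?_
      have hjr : j v ≤ r := (mem_filter.1 (hIT₁ hv)).2
      have hle : (1 + #{u ∈ T₁ | G.Adj v u}) * (r - j v) ≤ r * (r - j v) := by
        rcases hjr.eq_or_lt with h | h
        · simp [h]
        · exact Nat.mul_le_mul_right _ (by have := hdeg v; omega)
      calc _ ≤ r * (r - j v) + r * j v := Nat.add_le_add_right hle _
        _ = r * r := by rw [← mul_add, Nat.sub_add_cancel hjr]
    rw [sum_const, smul_eq_mul] at this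
    have h₂ : r * (r * #I) = #I * (r * r) := by ring
    omega
  have hT₁sum : r * #T₁ = ∑ v ∈ T₁, (r - j v) + ∑ v ∈ T₁, j v := by
    rw [← sum_add_distrib, mul_comm, ← smul_eq_mul, ← sum_const]
    exact sum_congr rfl fun v hv => (Nat.sub_add_cancel (mem_filter.1 hv).2).symm
  have hT₂sum : r * #T₂ + #T₂ ≤ ∑ v ∈ T₂, j v := by
    rw [← Nat.succ_mul, mul_comm, ← smul_eq_mul, ← sum_const]
    exact sum_le_sum fun v hv => not_le.1 (mem_filter.1 hv).2
  have hcard : #T₁ + #T₂ = #T := card_filter_add_card_filter_not _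
  have hjsum : ∑ v ∈ T₁, j v + ∑ v ∈ T₂, j v = ∑ v ∈ T, j v :=
    sum_filter_add_sum_filter_not _ _ _
  have hA' : r * (r * #I) ≤ r * #S + r * ∑ v ∈ I, j v := by
    rw [← mul_add]; exact Nat.mul_le_mul_left _ hA
  change r * #T ≤ r * #S + ∑ v ∈ T, j v ∧ _ ≤ r * #S + ∑ v ∈ T, j v + 1
  change r * #I ≤ #S + ∑ v ∈ I, j v at hA
  rw [← hcard, ← hjsum, mul_add]
  refine ⟨by omega, ?_⟩
  obtain ⟨k, rfl⟩ := Nat.exists_eq_add_of_lt hr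
  simp only [zero_add] at *
  have hA'' : k * ((k + 1) * #I) ≤ k * #S + k * ∑ v ∈ I, j v := by
    rw [← mul_add]; exact Nat.mul_le_mul_left _ hA
  have e₁ : (k + 1) * ((k + 1) * #I) = k * ((k + 1) * #I) + (k + 1) * #I := by ring
  have e₂ : (k + 1) * ∑ v ∈ I, j v = k * ∑ v ∈ I, j v + ∑ v ∈ I, j v := by ring
  have e₃ : (k + 1) * #S = k * #S + #S := by ring
  omega


theorem card_connectedComponent_le_sup_edge {V : Type*} [Finite V] (G : SimpleGraph V)
    (a b : V) :
    Nat.card G.ConnectedComponent ≤ Nat.card (G ⊔ edge a b).ConnectedComponent + 1 := by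
  let φ : V → G.ConnectedComponent := fun x =>
    if G.connectedComponentMk x = G.connectedComponentMk a then G.connectedComponentMk b
    else G.connectedComponentMk x
  have hφ : ∀ u v, (G ⊔ edge a b).Adj u v → φ u = φ v := by
    intro u v h
    rw [sup_adj, edge_adj] at h
    rcases h with h | ⟨⟨rfl, rfl⟩ | ⟨rfl, rfl⟩, -⟩
    · simp only [φ, ConnectedComponent.sound h.reachable]
    · simp only [φ, if_true]; split_ifs <;> rfl
    · simp only [φ, if_true]; split_ifs <;> rfl
  rw [← Finite.card_option]
  refine Nat.card_le_card_of_injective (fun c => if c = G.connectedComponentMk a then none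
    else some (c.map (Hom.ofLE le_sup_left))) fun c d => ?_
  induction c using ConnectedComponent.ind with | h x =>
  induction d using ConnectedComponent.ind with | h y =>
  dsimp only
  split_ifs with hx hy hy
  · exact fun _ => hx.trans hy.symm
  · exact fun h => by simp at h
  · exact fun h => by simp at h
  · intro h
    have := eq_of_connectedComponentMk_eq hφ (Option.some.inj h)
    change φ x = φ y at this
    simpa only [φ, if_neg hx, if_neg hy] using this

/-- Deleting the edges joining the pairs in `P` creates at most `#P` new components. -/
theorem card_connectedComponent_le_add_card {V : Type*} [Finite V] (G H : SimpleGraph V)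
    (P : Finset (V × V)) (h : ∀ u v, H.Adj u v → G.Adj u v ∨ (u, v) ∈ P ∨ (v, u) ∈ P) :
    Nat.card G.ConnectedComponent ≤ Nat.card H.ConnectedComponent + #P := by
  induction P using Finset.induction_on generalizing G with
  | empty => exact ConnectedComponent.card_le_card_of_le fun u v huv => by simpa using h u v huv
  | insert p P hp ih =>
    rw [card_insert_of_notMem hp]
    have := ih (G ⊔ edge p.1 p.2) fun u v huv => by
      have hne := huv.ne
      have := h u v huv
      simp only [mem_insert, sup_adj, edge_adj, Prod.ext_iff] at this ⊢
      tauto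
    have := card_connectedComponent_le_sup_edge G p.1 p.2
    omega

theorem supp_connectedComponentMk_eq_pair {V : Type*} {G : SimpleGraph V} {a b : V}
    (h : G.Adj a b) (ha : ∀ w, G.Adj a w → w = b) (hb : ∀ w, G.Adj b w → w = a) :
    (G.connectedComponentMk a).supp = {a, b} := by
  ext x
  rw [ConnectedComponent.mem_supp_iff, Set.mem_insert_iff, Set.mem_singleton_iff]
  constructor
  · intro hx
    have := eq_of_connectedComponentMk_eq (φ := fun x => x = a ∨ x = b) (fun u v huv => by
      refine propext ⟨?_, ?_⟩
      · rintro (rfl | rfl)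
        exacts [.inr (ha _ huv), .inl (hb _ huv)]
      · rintro (rfl | rfl)
        exacts [.inr (ha _ huv.symm), .inl (hb _ huv.symm)]) hx
    exact this.mpr (.inl rfl)
  · rintro (rfl | rfl)
    exacts [rfl, ConnectedComponent.sound h.symm.reachable]

/-- A gadget whose perfect matchings encode the spanning subgraphs `F` of `G` in which every
degree is at least `r` and the excesses over `r` sum to `k`: there are `r` copies of every vertex,
each dart `(u, v)` is joined to the copies of `u` and to the reverse dart, and `k` extra vertices
are joined to all darts. A dart is matched with its reverse iff its edge is not in `F`. -/
def factorGadget {V : Type*} (G : SimpleGraph V) (r k : ℕ) :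
    SimpleGraph ((V × Fin r) ⊕ G.Dart ⊕ Fin k) where
  Adj
    | .inl p, .inr (.inl d) => d.fst = p.1
    | .inr (.inl d), .inl p => d.fst = p.1
    | .inr (.inl d), .inr (.inl e) => e = d.symm
    | .inr (.inl _), .inr (.inr _) => True
    | .inr (.inr _), .inr (.inl _) => True
    | _, _ => False
  symm := ⟨by
    rintro (p | d | z) (q | e | y) h
    any_goals exact h
    change e = d.symm at h
    change d = e.symm
    rw [h, Dart.symm_symm]⟩
  loopless := ⟨by
    rintro (p | d | z) h
    exacts [h, d.symm_ne h.symm, h]⟩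

/-- Under the inequalities of `factor_inequalities`, the gadget nearly satisfies Tutte's
condition. -/
theorem ncard_oddComponents_factorGadget_le {V : Type*} [Fintype V] {G : SimpleGraph V}
    {r k : ℕ} (hk : k ≤ 1)
    (h₁ : ∀ S T : Finset V, Disjoint S T →
      r * #T ≤ r * #S + ∑ v ∈ T, #{u ∈ Sᶜ | G.Adj v u})
    (h₂ : ∀ S T : Finset V, Disjoint S T →
      r * #T + G.compCount (S ∪ T) ≤ r * #S + ∑ v ∈ T, #{u ∈ Sᶜ | G.Adj v u} + 1)
    (X : Set ((V × Fin r) ⊕ G.Dart ⊕ Fin k)) :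
    ((⊤ : (G.factorGadget r k).Subgraph).deleteVerts X).coe.oddComponents.ncard ≤
      X.ncard + 1 := by
  set K := ((⊤ : (G.factorGadget r k).Subgraph).deleteVerts X).coe with hK
  have hmem : ∀ {x}, x ∉ X → x ∈ ((⊤ : (G.factorGadget r k).Subgraph).deleteVerts X).verts :=
    fun hx => ⟨trivial, hx⟩
  have hadjK : ∀ {x y}, K.Adj x y ↔ (G.factorGadget r k).Adj x.1 y.1 := by
    rintro ⟨x, hx⟩ ⟨y, hy⟩
    simp [hK, hx.2, hy.2]
  let γ : ∀ x, x ∉ X → K.ConnectedComponent := fun x hx => K.connectedComponentMk ⟨x, hmem hx⟩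
  have hγ : ∀ {x y} (hx : x ∉ X) (hy : y ∉ X), (G.factorGadget r k).Adj x y → γ x hx = γ y hy :=
    fun hx hy h => ConnectedComponent.sound (hadjK.2 h : K.Adj ⟨_, hmem hx⟩ ⟨_, hmem hy⟩).reachable
  have hγsurj : ∀ c : K.ConnectedComponent, ∃ x hx, γ x hx = c := by
    intro c
    obtain ⟨⟨x, hx⟩, rfl⟩ := c.exists_rep
    exact ⟨x, hx.2, rfl⟩
  set S : Finset V := {v | ∀ i, .inl (v, i) ∈ X} with hS
  set T : Finset V := {v | v ∉ S ∧ ∀ d : G.Dart, d.fst = v → .inr (.inl d) ∈ X} with hT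
  have hST : Disjoint S T := Finset.disjoint_right.2 fun v hv => (mem_filter.1 hv).2.1
  have hSX : ∀ {v}, v ∉ S → ∃ i, .inl (v, i) ∉ X := by
    intro v hv; simpa [hS] using hv
  have hdartT : ∀ {d : G.Dart}, .inr (.inl d) ∉ X → d.fst ∉ T :=
    fun hd h => hd ((mem_filter.1 h).2.2 _ rfl)
  set XD : Finset G.Dart := {d | .inr (.inl d) ∈ X} with hXD
  set D₁ : Finset G.Dart := {d ∈ XD | d.fst ∈ T ∧ d.snd ∉ S} with hD₁
  have hXcard : r * #S + #XD ≤ X.ncard := by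
    rw [Set.ncard_eq_toFinset_card']
    calc r * #S + #XD = #((S ×ˢ (univ : Finset (Fin r))).disjSum (XD.disjSum ∅)) := by
          simp [mul_comm]
      _ ≤ _ := card_le_card fun x hx => ?_
    rw [Set.mem_toFinset]
    rcases x with ⟨v, i⟩ | d | z
    · simp only [inl_mem_disjSum, mem_product, hS, mem_filter] at hx
      exact hx.1.2 i
    · simpa [hXD] using hx
    · simp at hx
  have hD₁card : ∑ v ∈ T, #{u ∈ Sᶜ | G.Adj v u} ≤ #D₁ := by
    rw [card_eq_sum_card_fiberwise (f := fun d : G.Dart => d.fst) (t := T)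
      fun d hd => (mem_filter.1 hd).2.1]
    refine sum_le_sum fun v hv => ?_
    refine (card_le_card (t := image (fun d : G.Dart => d.snd) {d ∈ D₁ | d.fst = v})
      fun u hu => ?_).trans card_image_le
    rw [mem_filter, mem_compl] at hu
    refine mem_image.2 ⟨⟨(v, u), hu.2⟩, ?_, rfl⟩
    simp only [hD₁, hXD, mem_filter, mem_univ, true_and, and_true]
    exact ⟨(mem_filter.1 hv).2.2 _ rfl, hv, hu.1⟩
  have hcopyD : ∀ {v i} {d : G.Dart} (hv : .inl (v, i) ∉ X) (hd : .inr (.inl d) ∉ X),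
      d.fst = v → γ _ hv = γ _ hd := fun hv hd h => hγ hv hd h
  rw [Set.ncard_eq_toFinset_card']
  by_cases hz : ∃ z : Fin k, .inr (.inr z) ∉ X
  · obtain ⟨z, hz⟩ := hz
    have hcount : #K.oddComponents.toFinset ≤
        #(insert (.inr (.inr z)) ((T ×ˢ univ).disjSum ∅) :
          Finset ((V × Fin r) ⊕ G.Dart ⊕ Fin k)) := by
      refine card_le_card_of_forall_subsingleton (fun c x => ∃ hx, γ x hx = c) (fun c _ => ?_)
        fun x _ c hc d hd => ?_
      · have hdart : ∀ {d : G.Dart} (hd : .inr (.inl d) ∉ X), γ _ hd = γ _ hz :=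
          fun hd => hγ hd hz trivial
        obtain ⟨x, hx, rfl⟩ := hγsurj c
        rcases x with ⟨v, i⟩ | d | y
        · by_cases hvT : v ∈ T
          · exact ⟨_, mem_insert_of_mem (by simpa using hvT), hx, rfl⟩
          · have hvS : v ∉ S := fun h => hx ((mem_filter.1 h).2 i)
            obtain ⟨d, hdv, hd⟩ : ∃ d : G.Dart, d.fst = v ∧ .inr (.inl d) ∉ X := by
              simpa [hT, hvS] using hvT
            exact ⟨_, mem_insert_self _ _, hz, ((hcopyD hx hd hdv).trans (hdart hd)).symm⟩
        · exact ⟨_, mem_insert_self _ _, hz, (hdart hx).symm⟩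
        · exact ⟨_, mem_insert_self _ _, hz, by
            have := Fin.subsingleton_iff_le_one.2 hk; cases Subsingleton.elim z y; rfl⟩
      · obtain ⟨-, hx, rfl⟩ := hc
        obtain ⟨-, -, rfl⟩ := hd
        rfl
    have := card_insert_le (.inr (.inr z)) ((T ×ˢ univ).disjSum ∅ :
          Finset ((V × Fin r) ⊕ G.Dart ⊕ Fin k))
    have hTr : #((T ×ˢ univ).disjSum ∅ : Finset ((V × Fin r) ⊕ G.Dart ⊕ Fin k)) = r * #T := by
      simp [mul_comm]
    have := h₁ S T hST
    have : #D₁ ≤ #XD := card_filter_le _ _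
    omega
  · push Not at hz
    let U : Set V := (↑(S ∪ T))ᶜ
    let A : SimpleGraph U :=
      { Adj := fun u v => ∃ h : G.Adj u v,
          .inr (.inl ⟨(u, v), h⟩) ∉ X ∧ .inr (.inl ⟨(v, u), h.symm⟩) ∉ X
        symm := ⟨fun u v ⟨h, h₁, h₂⟩ => ⟨h.symm, h₂, h₁⟩⟩
        loopless := ⟨fun u ⟨h, _⟩ => G.irrefl h⟩ }
    have hUmem : ∀ {v}, v ∈ U ↔ v ∉ S ∧ v ∉ T := by
      intro v; simp [U]
    have hUdart : ∀ v : U, ∃ d : G.Dart, d.fst = v ∧ .inr (.inl d) ∉ X := by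
      rintro ⟨v, hv⟩
      have hv := hUmem.1 hv
      simpa [hT, hv.1] using hv.2
    choose δ hδ hδX using hUdart
    let p : U → K.ConnectedComponent := fun v => γ _ (hδX v)
    have hp : ∀ (v : U) (d : G.Dart) (hd : .inr (.inl d) ∉ X), d.fst = v → γ _ hd = p v := by
      intro v d hd hdv
      obtain ⟨i, hi⟩ := hSX (hUmem.1 v.2).1
      exact (hcopyD hi hd hdv).symm.trans (hcopyD hi (hδX v) (hδ v))
    have hpA : ∀ u v, A.Adj u v → p u = p v := by
      rintro u v ⟨h, h₁, h₂⟩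
      rw [← hp u _ h₁ rfl, ← hp v _ h₂ rfl]
      exact hγ h₁ h₂ rfl
    let q : A.ConnectedComponent → K.ConnectedComponent :=
      ConnectedComponent.lift p fun u v w _ =>
        eq_of_connectedComponentMk_eq hpA (ConnectedComponent.sound ⟨w⟩)
    set D₂ : Finset G.Dart := {d ∈ XD | d.snd ∈ S} with hD₂
    set D₃ : Finset G.Dart := {d ∈ XD | d.fst ∈ U ∧ d.snd ∈ U} with hD₃
    have hD : #D₁ + #D₂ + #D₃ ≤ #XD := by
      rw [← card_union_of_disjoint, ← card_union_of_disjoint]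
      · exact card_le_card (union_subset (union_subset (filter_subset _ _) (filter_subset _ _))
          (filter_subset _ _))
      · refine Finset.disjoint_left.2 fun d hd hd' => ?_
        have hd' := (mem_filter.1 hd').2
        rcases mem_union.1 hd with hd | hd
        · exact (hUmem.1 hd'.1).2 (mem_filter.1 hd).2.1
        · exact (hUmem.1 hd'.2).1 (mem_filter.1 hd).2
      · exact Finset.disjoint_left.2 fun d hd hd' =>
          (mem_filter.1 hd).2.2 (mem_filter.1 hd').2
    have hA : Nat.card A.ConnectedComponent ≤ G.compCount (S ∪ T) + #D₃ := by
      let P : Finset (U × U) := {x | ∃ d ∈ D₃, d.fst = x.1 ∧ d.snd = x.2}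
      refine (card_connectedComponent_le_add_card A (G.induce U) P fun u v h => ?_).trans
        (Nat.add_le_add_left ?_ _)
      · have h : G.Adj u v := h
        by_cases hu : .inr (.inl ⟨(↑u, ↑v), h⟩) ∈ X
        · exact .inr (.inl (by
            simp only [P, hD₃, hXD, mem_filter, mem_univ, true_and]
            exact ⟨_, ⟨hu, u.2, v.2⟩, rfl, rfl⟩))
        by_cases hv : .inr (.inl ⟨(↑v, ↑u), h.symm⟩) ∈ X
        · exact .inr (.inr (by
            simp only [P, hD₃, hXD, mem_filter, mem_univ, true_and]
            exact ⟨_, ⟨hv, v.2, u.2⟩, rfl, rfl⟩))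
        exact .inl ⟨h, hu, hv⟩
      · refine card_le_card_of_forall_subsingleton
          (fun x d => d.fst = x.1 ∧ d.snd = x.2) (fun x hx => (mem_filter.1 hx).2) ?_
        rintro d - ⟨x₁, x₂⟩ hx ⟨y₁, y₂⟩ hy
        exact Prod.ext (Subtype.ext (hx.2.1.symm.trans hy.2.1))
          (Subtype.ext (hx.2.2.symm.trans hy.2.2))
    have hcount : #K.oddComponents.toFinset ≤
        #(((T ×ˢ univ).disjSum (D₂.disjSum ∅) :
          Finset ((V × Fin r) ⊕ G.Dart ⊕ Fin k)).disjSum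
            (univ : Finset A.ConnectedComponent)) := by
      -- a dart at a vertex of `S` is labelled by its reverse
      let lab : (V × Fin r) ⊕ G.Dart ⊕ Fin k → (V × Fin r) ⊕ G.Dart ⊕ Fin k :=
        Sum.map id (Sum.map Dart.symm id)
      refine card_le_card_of_forall_subsingleton
        (fun c => Sum.elim (fun x => ∃ hx, γ (lab x) hx = c) (fun a => q a = c))
        (fun c hc => ?_) fun x _ c hc d hd => ?_
      · have hdart : ∀ {d : G.Dart} (hd : .inr (.inl d) ∉ X), d.fst ∉ S →
            ∃ a, q a = γ _ hd := by
          intro d hd hdS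
          exact ⟨A.connectedComponentMk ⟨d.fst, hUmem.2 ⟨hdS, hdartT hd⟩⟩,
            (hp ⟨d.fst, hUmem.2 ⟨hdS, hdartT hd⟩⟩ d hd rfl).symm⟩
        obtain ⟨x, hx, rfl⟩ := hγsurj c
        rcases x with ⟨v, i⟩ | d | y
        · by_cases hvT : v ∈ T
          · exact ⟨.inl (.inl (v, i)), by simpa using hvT, hx, rfl⟩
          · have hvS : v ∉ S := fun h => hx ((mem_filter.1 h).2 i)
            refine ⟨.inr (A.connectedComponentMk ⟨v, hUmem.2 ⟨hvS, hvT⟩⟩), by simp, ?_⟩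
            exact (hcopyD hx (hδX ⟨v, hUmem.2 ⟨hvS, hvT⟩⟩) (hδ _)).symm
        · by_cases hdS : d.fst ∈ S
          · by_cases hdX : .inr (.inl d.symm) ∈ X
            · have hlab : lab (.inr (.inl d.symm)) = .inr (.inl d) := by simp [lab]
              refine ⟨.inl (.inr (.inl d.symm)), ?_, ?_⟩
              · simpa [hD₂, hXD] using ⟨hdX, hdS⟩
              · simp only [Sum.elim_inl, hlab]
                exact ⟨hx, trivial⟩
            · have heq : γ _ hdX = γ _ hx := hγ hdX hx d.symm_symm.symm
              by_cases hdS' : d.snd ∈ S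
              · have hnbr : ∀ e : G.Dart, e.fst ∈ S →
                    ∀ w : ((⊤ : (G.factorGadget r k).Subgraph).deleteVerts X).verts,
                    (G.factorGadget r k).Adj (.inr (.inl e)) w.1 → w.1 = .inr (.inl e.symm) := by
                  rintro e he ⟨⟨v, i⟩ | e' | y, hw⟩ hew
                  · have hew : e.fst = v := hew
                    exact absurd ((mem_filter.1 he).2 i) (hew ▸ hw.2)
                  · exact congrArg (Sum.inr ∘ Sum.inl) hew
                  · exact absurd (hz y) hw.2
                have hsupp : (γ _ hx).supp = {⟨_, hmem hx⟩, ⟨_, hmem hdX⟩} :=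
                  supp_connectedComponentMk_eq_pair (hadjK.2 rfl)
                    (fun w hw => Subtype.ext (hnbr d hdS w (hadjK.1 hw)))
                    (fun w hw => Subtype.ext ((hnbr d.symm hdS' w (hadjK.1 hw)).trans
                      (by rw [Dart.symm_symm])))
                have hodd : Odd (γ _ hx).supp.ncard := by simpa using hc
                rw [hsupp, Set.ncard_pair (fun h => d.symm_ne (by simpa using h.symm))] at hodd
                exact absurd hodd (by decide)
              · obtain ⟨a, ha⟩ := hdart hdX hdS'
                exact ⟨.inr a, by simp, ha.trans heq⟩
          · obtain ⟨a, ha⟩ := hdart hx hdS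
            exact ⟨.inr a, by simp, ha⟩
        · exact absurd (hz y) hx
      · rcases x with x | a
        · obtain ⟨-, hx, rfl⟩ := hc
          obtain ⟨-, -, rfl⟩ := hd
          rfl
        · exact hc.2.symm.trans hd.2
    have hlabels : #(((T ×ˢ univ).disjSum (D₂.disjSum ∅) :
          Finset ((V × Fin r) ⊕ G.Dart ⊕ Fin k)).disjSum
            (univ : Finset A.ConnectedComponent)) =
        r * #T + #D₂ + Nat.card A.ConnectedComponent := by
      simp [mul_comm, Nat.card_eq_fintype_card]
    have := h₂ S T hST
    omega


theorem exists_isPerfectMatching_factorGadget {V : Type*} [Fintype V] {G : SimpleGraph V}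
    {r k : ℕ} (hk : k ≤ 1) (hrk : Even (r * Fintype.card V + k))
    (h₁ : ∀ S T : Finset V, Disjoint S T →
      r * #T ≤ r * #S + ∑ v ∈ T, #{u ∈ Sᶜ | G.Adj v u})
    (h₂ : ∀ S T : Finset V, Disjoint S T →
      r * #T + G.compCount (S ∪ T) ≤ r * #S + ∑ v ∈ T, #{u ∈ Sᶜ | G.Adj v u} + 1) :
    ∃ M : (G.factorGadget r k).Subgraph, M.IsPerfectMatching := by
  refine tutte.2 fun X hX => ?_
  have hle := ncard_oddComponents_factorGadget_le hk h₁ h₂ X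
  have hX : X.ncard < _ := hX
  have hodd := odd_ncard_oddComponents ((⊤ : (G.factorGadget r k).Subgraph).deleteVerts X).coe
  have hcard : Nat.card ((⊤ : (G.factorGadget r k).Subgraph).deleteVerts X).verts + X.ncard =
      r * Fintype.card V + k + 2 * #G.edgeFinset := by
    rw [Nat.card_coe_set_eq, Subgraph.deleteVerts_verts, Subgraph.verts_top,
      Set.ncard_sdiff_add_ncard_of_subset (Set.subset_univ X), Set.ncard_univ,
      Nat.card_eq_fintype_card]
    simp only [Fintype.card_sum, Fintype.card_prod, Fintype.card_fin]
    rw [← dart_card_eq_twice_card_edges]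
    ring
  rw [Nat.odd_iff, Nat.odd_iff] at hodd
  rw [Nat.even_iff] at hrk
  omega

theorem hasNearRegularFactor_of_isPerfectMatching_factorGadget {V : Type*} [Fintype V]
    {G : SimpleGraph V} {r k : ℕ} (hk : k ≤ 1) {M : (G.factorGadget r k).Subgraph}
    (hM : M.IsPerfectMatching) : G.HasNearRegularFactor r := by
  have := Fin.subsingleton_iff_le_one.2 hk
  choose m hm hmu using Subgraph.isPerfectMatching_iff.1 hM
  have hmm : ∀ {x y}, m x = y → m y = x := fun {x y} h => (hmu y x (h ▸ hm x).symm).symm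
  let F : SimpleGraph V :=
    { Adj := fun u v => ∃ h : G.Adj u v,
        m (.inr (.inl ⟨(u, v), h⟩)) ≠ .inr (.inl ⟨(v, u), h.symm⟩)
      symm := ⟨fun u v ⟨h, hne⟩ => ⟨h.symm, fun h' => hne (hmm h')⟩⟩
      loopless := ⟨fun u ⟨h, _⟩ => G.irrefl h⟩ }
  -- the extra vertices matched with darts at `v`
  let E : V → Finset (Fin k) := fun v =>
    {z | ∃ d : G.Dart, d.fst = v ∧ m (.inr (.inr z)) = .inr (.inl d)}
  have hcopy : ∀ v i, ∃ d : G.Dart, d.fst = v ∧ m (.inl (v, i)) = .inr (.inl d) := by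
    intro v i
    have h := (hm (.inl (v, i))).adj_sub
    rcases hw : m (.inl (v, i)) with p | d | z <;> rw [hw] at h
    · exact h.elim
    · exact ⟨d, h, rfl⟩
    · exact h.elim
  have hFdart : ∀ d : G.Dart, F.Adj d.fst d.snd ↔ m (.inr (.inl d)) ≠ .inr (.inl d.symm) :=
    fun d => ⟨fun ⟨_, h⟩ => h, fun h => ⟨d.adj, h⟩⟩
  have hdeg : ∀ v [Fintype (F.neighborSet v)], F.degree v = r + #(E v) := by
    intro v _
    have hcard : #((univ : Finset (Fin r)).disjSum (E v)) = r + #(E v) := by simp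
    rw [← hcard, ← card_neighborFinset_eq_degree, eq_comm]
    let ι : Fin r ⊕ Fin k → (V × Fin r) ⊕ G.Dart ⊕ Fin k :=
      Sum.elim (fun i => .inl (v, i)) fun z => .inr (.inr z)
    have hpartner : ∀ x ∈ (univ : Finset (Fin r)).disjSum (E v), ∃ d : G.Dart, d.fst = v ∧
        m (ι x) = .inr (.inl d) := by
      rintro (i | z) hx
      · exact hcopy v i
      · exact (mem_filter.1 (inr_mem_disjSum.1 hx)).2
    choose D hDv hDm using hpartner
    refine card_bij (fun x hx => (D x hx).snd) (fun x hx => ?_) (fun x hx y hy h => ?_)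
      fun u hu => ?_
    · have hF := hFdart (D x hx)
      rw [hDv, hmm (hDm x hx)] at hF
      rw [mem_neighborFinset, hF]
      rcases x with i | z <;> simp [ι]
    · have hD : D x hx = D y hy := Dart.ext _ _ (Prod.ext ((hDv x hx).trans (hDv y hy).symm) h)
      have hxy : ι x = ι y := by rw [← hmm (hDm x hx), ← hmm (hDm y hy), hD]
      rcases x with i | z <;> rcases y with j | y <;> simp [ι] at hxy
      exacts [congrArg _ hxy, congrArg _ hxy]
    · obtain ⟨h, hne⟩ := (mem_neighborFinset _ _ _).1 hu
      obtain ⟨x, hx, hxm⟩ : ∃ x ∈ (univ : Finset (Fin r)).disjSum (E v),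
          m (.inr (.inl ⟨(v, u), h⟩)) = ι x := by
        have hadj := (hm (.inr (.inl ⟨(v, u), h⟩))).adj_sub
        rcases hw : m (.inr (.inl ⟨(v, u), h⟩)) with ⟨w, i⟩ | e | z <;> rw [hw] at hadj
        · obtain rfl : v = w := hadj
          exact ⟨.inl i, by simp, rfl⟩
        · obtain rfl : e = Dart.symm _ := hadj
          exact absurd hw hne
        · exact ⟨.inr z, inr_mem_disjSum.2 (mem_filter.2 ⟨mem_univ _, _, rfl, hmm hw⟩), rfl⟩
      refine ⟨x, hx, ?_⟩
      have := (hDm x hx).symm.trans (hmm hxm)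
      rw [Sum.inl_injective (Sum.inr_injective this)]
  refine ⟨F, fun u v h => h.1, fun v => ?_, fun u v hu hv => ?_⟩
  · have : #(E v) ≤ 1 := card_le_one_of_subsingleton _
    rw [hdeg]; omega
  · rw [hdeg] at hu hv
    obtain ⟨z, hz⟩ := card_pos.1 (show 0 < #(E u) by omega)
    obtain ⟨y, hy⟩ := card_pos.1 (show 0 < #(E v) by omega)
    obtain rfl := Subsingleton.elim z y
    obtain ⟨-, d, rfl, hd⟩ := mem_filter.1 hz
    obtain ⟨-, e, rfl, he⟩ := mem_filter.1 hy
    rw [hd] at he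
    rw [Sum.inl_injective (Sum.inr_injective he)]

end SimpleGraph

/-- if for every `S ⊆ V(G)` we have `iso(G−S) ≤ |S|/r` and
`(r−1)·w_*(G−S) + ω(G−S) ≤ |S| + 1`, then `G` admits a near `r`-factor. -/
theorem near_r_factor_of_iso_and_star_bounds {V : Type*} [Fintype V] (G : SimpleGraph V)
    (r : ℕ) (hr : 0 < r)
    (hiso : ∀ S : Finset V, (G.isoCount S : ℝ) ≤ (S.card : ℝ) / r)
    (hstar : ∀ S : Finset V,
      (r - 1) * G.starCompCount S + G.compCount S ≤ S.card + 1) :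
    G.HasNearRegularFactor r := by
  have hiso' : ∀ S : Finset V, r * G.isoCount S ≤ #S := fun S => by
    have := (le_div_iff₀' (Nat.cast_pos.2 hr)).1 (hiso S)
    exact_mod_cast this
  have key := fun S T => G.factor_inequalities (S := S) (T := T) hr hiso' hstar
  have hk : (r * Fintype.card V) % 2 ≤ 1 := by omega
  obtain ⟨M, hM⟩ := SimpleGraph.exists_isPerfectMatching_factorGadget hk
    (Nat.even_iff.2 (by omega)) (fun S T h => (key S T h).1) fun S T h => (key S T h).2
  exact SimpleGraph.hasNearRegularFactor_of_isPerfectMatching_factorGadget hk hM
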